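/- Suppose λ := λ_min[H] < 0 and u is an eigenvector of H for λ with ‖u‖₂ = 1 and N(u) ≤ 1, whose sign is chosen so that ⟨g, u⟩ ≤ 0. Then, with α := −3λ/(2σ) > 0, one has m(α u) ≤ m(0) + 9λ³/(16σ²), i.e. m(α u) ≤ m(0) − (9/(16σ²))|λ_min[H]|³ < m(0). -/

import Mathlib

open scoped RealInnerProductSpace

noncomputable section

/-- Abbreviation for the Euclidean space `ℝ^n`. -/
abbrev E (n : ℕ) := EuclideanSpace ℝ (Fin n)

/-- `N` is a norm on `ℝ^n` (possibly non-smooth, e.g. `ℓ¹` or `ℓ∞`). -/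
structure IsNorm (n : ℕ) (N : E n → ℝ) : Prop where
  add_le : ∀ x y, N (x + y) ≤ N x + N y
  smul : ∀ (c : ℝ) (x : E n), N (c • x) = |c| * N x
  eq_zero : ∀ x, N x = 0 → x = 0

/-- The dual norm `‖v‖_{N,1} := max_{N s = 1} ⟪v, s⟫`. -/
def dualNorm (n : ℕ) (N : E n → ℝ) (v : E n) : ℝ :=
  sSup {t : ℝ | ∃ s, N s = 1 ∧ t = ⟪v, s⟫}

/-- The smallest eigenvalue of a symmetric operator `A`, as the infimum of the
Rayleigh quotient over the Euclidean unit sphere. -/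
def lamMin (n : ℕ) (A : E n →L[ℝ] E n) : ℝ :=
  sInf {t : ℝ | ∃ v : E n, ‖v‖ = 1 ∧ t = ⟪A v, v⟫}

/-- The norm `‖H‖_{N,2} := max_{N s = 1} |⟪H s, s⟫|` of a symmetric operator induced by `N`. -/
def matNormN (n : ℕ) (N : E n → ℝ) (A : E n →L[ℝ] E n) : ℝ :=
  sSup {t : ℝ | ∃ v : E n, N v = 1 ∧ t = |⟪A v, v⟫|}

/-- The regularized quadratic model
`m(s) = f₀ + ⟪g,s⟫ + (1/2)⟪Hs,s⟫ + (σ/6) N(s)³`. -/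
def qm (n : ℕ) (N : E n → ℝ) (f0 : ℝ) (g : E n) (H : E n →L[ℝ] E n) (σ : ℝ)
    (s : E n) : ℝ :=
  f0 + ⟪g, s⟫ + (1 / 2) * ⟪H s, s⟫ + σ / 6 * N s ^ 3

/-- A norm in the sense of `IsNorm` is nonnegative. -/
theorem IsNorm.nonneg {n : ℕ} {N : E n → ℝ} (hN : IsNorm n N) (x : E n) : 0 ≤ N x := by
  have h := hN.add_le x ((-1 : ℝ) • x)
  rw [hN.smul, neg_one_smul, add_neg_cancel, ← zero_smul ℝ x, hN.smul] at h
  norm_num at h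
  linarith

theorem IsNorm.map_zero {n : ℕ} {N : E n → ℝ} (hN : IsNorm n N) : N 0 = 0 := by
  simpa using hN.smul 0 0

theorem qm_zero {n : ℕ} {N : E n → ℝ} (hN : IsNorm n N) (f0 : ℝ) (g : E n)
    (H : E n →L[ℝ] E n) (σ : ℝ) : qm n N f0 g H σ 0 = f0 := by
  simp [qm, hN.map_zero]

/-- Upper bound for the model along a unit eigenvector of nonascent. -/
theorem qm_smul_le {n : ℕ} {N : E n → ℝ} (hN : IsNorm n N) (f0 : ℝ) {g : E n}
    {H : E n →L[ℝ] E n} {σ μ a : ℝ} (hσ : 0 ≤ σ) (ha : 0 ≤ a) {u : E n}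
    (hu : H u = μ • u) (hu2 : ‖u‖ = 1) (huN : N u ≤ 1) (hsign : ⟪g, u⟫ ≤ 0) :
    qm n N f0 g H σ (a • u) ≤ f0 + μ * a ^ 2 / 2 + σ / 6 * a ^ 3 := by
  have hlin : a * ⟪g, u⟫ ≤ 0 := mul_nonpos_of_nonneg_of_nonpos ha hsign
  have hcube : σ / 6 * (a * N u) ^ 3 ≤ σ / 6 * a ^ 3 := by
    have := mul_nonneg ha (hN.nonneg u)
    gcongr
    exact mul_le_of_le_one_right ha huN
  simp only [qm, map_smul, hu, real_inner_smul_left, real_inner_smul_right, hN.smul,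
    abs_of_nonneg ha, real_inner_self_eq_norm_sq, hu2]
  linarith

/-- decrease from the origin along negative curvature: if
`λ := λ_min[H] < 0`, `u` is a unit eigenvector for `λ` with `N(u) ≤ 1` and
`⟪g,u⟫ ≤ 0`, then with `α = −3λ/(2σ)` one has
`m(αu) ≤ m(0) + 9λ³/(16σ²) = m(0) − (9/(16σ²))|λ|³ < m(0)`. -/
theorem stmt18 {n : ℕ} (hn : 1 ≤ n) (N : E n → ℝ) (hN : IsNorm n N)
    (f0 : ℝ) (g : E n) (H : E n →L[ℝ] E n)
    (hH : ∀ x y : E n, ⟪H x, y⟫ = ⟪x, H y⟫)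
    (σ : ℝ) (hσ : 0 < σ)
    (hlam : lamMin n H < 0)
    (u : E n) (hu : H u = lamMin n H • u) (hu2 : ‖u‖ = 1) (huN : N u ≤ 1)
    (hsign : ⟪g, u⟫ ≤ 0) :
    qm n N f0 g H σ ((-3 * lamMin n H / (2 * σ)) • u) ≤
        qm n N f0 g H σ 0 + 9 * lamMin n H ^ 3 / (16 * σ ^ 2) ∧
      qm n N f0 g H σ ((-3 * lamMin n H / (2 * σ)) • u) ≤
        qm n N f0 g H σ 0 - 9 / (16 * σ ^ 2) * |lamMin n H| ^ 3 ∧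
      qm n N f0 g H σ ((-3 * lamMin n H / (2 * σ)) • u) < qm n N f0 g H σ 0 := by
  have hbound := qm_smul_le hN f0 hσ.le
    (div_nonneg (by linarith) (by positivity) : 0 ≤ -3 * lamMin n H / (2 * σ)) hu hu2 huN hsign
  have hval : f0 + lamMin n H * (-3 * lamMin n H / (2 * σ)) ^ 2 / 2 +
      σ / 6 * (-3 * lamMin n H / (2 * σ)) ^ 3 = f0 + 9 * lamMin n H ^ 3 / (16 * σ ^ 2) := by
    field_simp
    ring
  have habs : 9 / (16 * σ ^ 2) * |lamMin n H| ^ 3 = -(9 * lamMin n H ^ 3 / (16 * σ ^ 2)) := by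
    rw [abs_of_neg hlam]
    ring
  have hneg : 9 * lamMin n H ^ 3 / (16 * σ ^ 2) < 0 :=
    div_neg_of_neg_of_pos (by linarith [Odd.pow_neg (by decide : Odd 3) hlam]) (by positivity)
  rw [qm_zero hN]
  refine ⟨?_, ?_, ?_⟩ <;> linarith
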